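/- Let g be in normal form, fix n ≥ 1, and assume a_{i,1} = 0 for 2 ≤ i ≤ n (no condition when n = 1) and a_{n+1,1} ≠ 0. Let θ₀ ∈ (−π/2, π/2), A(θ₀) = √(a_{n+1,1}² cos²θ₀ + ((n+1)!)² sin²θ₀), and ν₀ = σ·(0, −a_{n+1,1} cosθ₀ / A(θ₀), (n+1)! sinθ₀ / A(θ₀)) for a sign σ ∈ {1,−1}. Then the height function h_{ν₀} has an A₁ singularity at (0,0) if and only if a_{n+1,1} b₂ cosθ₀ − (n+1)! a_{2,0} sinθ₀ ≠ 0 (i.e., (0,θ₀) is not a parabolic point over the singularity of the surface). -/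

import Mathlib

open Real Set

noncomputable section

/-- Partial derivative in the first variable. -/
def pdu {F : Type*} [NormedAddCommGroup F] [NormedSpace ℝ F] (f : ℝ → ℝ → F) : ℝ → ℝ → F :=
  fun u w => deriv (fun t => f t w) u

/-- Partial derivative in the second variable. -/
def pdw {F : Type*} [NormedAddCommGroup F] [NormedSpace ℝ F] (f : ℝ → ℝ → F) : ℝ → ℝ → F :=
  fun u w => deriv (fun t => f u t) w

/-- Iterated partial derivative `∂_u^i ∂_w^j f`. -/
def pd {F : Type*} [NormedAddCommGroup F] [NormedSpace ℝ F] (i j : ℕ) (f : ℝ → ℝ → F) :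
    ℝ → ℝ → F :=
  pdu^[i] (pdw^[j] f)

/-- The Euclidean inner product on `ℝ³ = ℝ × ℝ × ℝ`. -/
def dot3 (x y : ℝ × ℝ × ℝ) : ℝ := x.1 * y.1 + x.2.1 * y.2.1 + x.2.2 * y.2.2

/-- The cross product on `ℝ³ = ℝ × ℝ × ℝ`. -/
def cross3 (x y : ℝ × ℝ × ℝ) : ℝ × ℝ × ℝ :=
  (x.2.1 * y.2.2 - x.2.2 * y.2.1, x.2.2 * y.1 - x.1 * y.2.2, x.1 * y.2.1 - x.2.1 * y.1)

/-- The Euclidean norm on `ℝ³ = ℝ × ℝ × ℝ`. -/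
def norm3 (x : ℝ × ℝ × ℝ) : ℝ := Real.sqrt (dot3 x x)

/-- The surface parameterization `g(u,w) = (u, p(u,w), q(u,w))`. -/
def gmap (p q : ℝ → ℝ → ℝ) : ℝ → ℝ → ℝ × ℝ × ℝ := fun u w => (u, p u w, q u w)

/-- The height function on the surface parameterized by `g = (u, p, q)` along `v`. -/
def hgt (p q : ℝ → ℝ → ℝ) (v : ℝ × ℝ × ℝ) : ℝ → ℝ → ℝ :=
  fun u w => dot3 (gmap p q u w) v

/-- `g = (u, p(u,w), q(u,w))` is in normal form of order `N`. -/
def NormalFormN (N : ℕ) (p q : ℝ → ℝ → ℝ) (b : ℕ → ℝ) (a : ℕ → ℕ → ℝ) : Prop :=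
  ContDiff ℝ (⊤ : ℕ∞) (fun x : ℝ × ℝ => p x.1 x.2) ∧
  ContDiff ℝ (⊤ : ℕ∞) (fun x : ℝ × ℝ => q x.1 x.2) ∧
  p 0 0 = 0 ∧ q 0 0 = 0 ∧
  pd 1 0 p 0 0 = 0 ∧ pd 0 1 p 0 0 = 0 ∧ pd 1 0 q 0 0 = 0 ∧ pd 0 1 q 0 0 = 0 ∧
  pd 0 2 p 0 0 = 1 ∧
  (∀ i, 2 ≤ i → i ≤ N → pd i 0 p 0 0 = b i) ∧
  (∀ i j, 2 ≤ i + j → i + j ≤ N → 1 ≤ j → ¬(i = 0 ∧ j = 2) → pd i j p 0 0 = 0) ∧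
  (∀ i j, 2 ≤ i + j → i + j ≤ N → pd i j q 0 0 = a i j) ∧
  a 1 1 = 0 ∧ a 0 2 = 0

/-- `h` has an `A_k` singularity at the origin: up to a `C^∞` change of coordinates fixing
the origin, `h` equals `h(0,0) ± x² ± y^(k+1)`. -/
def HasAkSingAt (h : ℝ → ℝ → ℝ) (k : ℕ) : Prop :=
  ∃ (U V : Set (ℝ × ℝ)) (φ ψ : ℝ × ℝ → ℝ × ℝ) (ε₁ ε₂ : ℝ),
    IsOpen U ∧ IsOpen V ∧ ((0, 0) : ℝ × ℝ) ∈ U ∧ ((0, 0) : ℝ × ℝ) ∈ V ∧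
    ContDiffOn ℝ (⊤ : ℕ∞) φ U ∧ ContDiffOn ℝ (⊤ : ℕ∞) ψ V ∧
    Set.MapsTo φ U V ∧ Set.MapsTo ψ V U ∧
    (∀ x ∈ U, ψ (φ x) = x) ∧ (∀ y ∈ V, φ (ψ y) = y) ∧
    φ (0, 0) = (0, 0) ∧ (ε₁ = 1 ∨ ε₁ = -1) ∧ (ε₂ = 1 ∨ ε₂ = -1) ∧
    ∀ x ∈ U, h (φ x).1 (φ x).2 = h 0 0 + ε₁ * x.1 ^ 2 + ε₂ * x.2 ^ (k + 1)

/-- The parabolic-set function `Σ = ⟨g_uu, g_u × g_w⟩⟨g_ww, g_u × g_w⟩ − ⟨g_uw, g_u × g_w⟩²`. -/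
def SigmaFun (p q : ℝ → ℝ → ℝ) : ℝ → ℝ → ℝ := fun u w =>
  dot3 (pd 2 0 (gmap p q) u w) (cross3 (pd 1 0 (gmap p q) u w) (pd 0 1 (gmap p q) u w)) *
      dot3 (pd 0 2 (gmap p q) u w) (cross3 (pd 1 0 (gmap p q) u w) (pd 0 1 (gmap p q) u w)) -
    dot3 (pd 1 1 (gmap p q) u w) (cross3 (pd 1 0 (gmap p q) u w) (pd 0 1 (gmap p q) u w)) ^ 2

/-- The torsion of a space curve `L`. -/
def tor (L : ℝ → ℝ × ℝ × ℝ) : ℝ → ℝ := fun t =>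
  dot3 (cross3 (deriv L t) (deriv (deriv L) t)) (deriv (deriv (deriv L)) t) /
    norm3 (cross3 (deriv L t) (deriv (deriv L) t)) ^ 2

/-- The unit binormal vector of a space curve `L` at `t = 0`. -/
def binormal0 (L : ℝ → ℝ × ℝ × ℝ) : ℝ × ℝ × ℝ :=
  (norm3 (cross3 (deriv L 0) (deriv (deriv L) 0)))⁻¹ • cross3 (deriv L 0) (deriv (deriv L) 0)

/-- `f` is a parabolic Monge form with `∂_w² f(0,0) = k₂ ≠ 0`. -/
def MongeForm (f : ℝ → ℝ → ℝ) (k₂ : ℝ) : Prop :=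
  ContDiff ℝ (⊤ : ℕ∞) (fun x : ℝ × ℝ => f x.1 x.2) ∧ f 0 0 = 0 ∧
  pd 1 0 f 0 0 = 0 ∧ pd 0 1 f 0 0 = 0 ∧
  pd 2 0 f 0 0 = 0 ∧ pd 1 1 f 0 0 = 0 ∧ pd 0 2 f 0 0 = k₂ ∧ k₂ ≠ 0

/-- The parabolic-set function `P = f_uu f_ww − f_uw²` of a Monge form. -/
def Pfun (f : ℝ → ℝ → ℝ) : ℝ → ℝ → ℝ := fun u w =>
  pd 2 0 f u w * pd 0 2 f u w - pd 1 1 f u w ^ 2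

open Filter Topology

/-- The derivative of a parametric interval integral with smooth integrand. -/
theorem hasFDerivAt_parametric_intervalIntegral {E F : Type*} [NormedAddCommGroup E]
    [NormedSpace ℝ E] [ProperSpace E] [NormedAddCommGroup F] [NormedSpace ℝ F]
    {f : E × ℝ → F} (hf : ContDiff ℝ 1 f) (c d : ℝ) (x₀ : E) :
    HasFDerivAt (fun x => ∫ t in c..d, f (x, t))
      (∫ t in c..d, (fderiv ℝ f (x₀, t)).comp (ContinuousLinearMap.inl ℝ E ℝ)) x₀ := by
  have hf' : Continuous fun y : E × ℝ =>
      (fderiv ℝ f y).comp (ContinuousLinearMap.inl ℝ E ℝ) :=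
    (hf.continuous_fderiv one_ne_zero).clm_comp continuous_const
  obtain ⟨C, hC⟩ := ((isCompact_closedBall x₀ 1).prod
    (isCompact_uIcc (a := c) (b := d))).exists_bound_of_continuousOn hf'.continuousOn
  refine intervalIntegral.hasFDerivAt_integral_of_dominated_of_fderiv_le
    (F' := fun x t => (fderiv ℝ f (x, t)).comp (ContinuousLinearMap.inl ℝ E ℝ))
    (bound := fun _ => C) (Metric.closedBall_mem_nhds x₀ one_pos) ?_ ?_ ?_ ?_ ?_ ?_
  · exact .of_forall fun x =>
      (hf.continuous.comp (Continuous.prodMk_right x)).aestronglyMeasurable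
  · exact (hf.continuous.comp (Continuous.prodMk_right x₀)).intervalIntegrable _ _
  · exact (hf'.comp (Continuous.prodMk_right x₀)).aestronglyMeasurable
  · exact .of_forall fun t ht x hx => hC (x, t) ⟨hx, Set.uIoc_subset_uIcc ht⟩
  · exact intervalIntegrable_const
  · refine .of_forall fun t _ x _ => ?_
    exact ((hf.differentiable one_ne_zero) (x, t)).hasFDerivAt.comp x (hasFDerivAt_prodMk_left x t)

/-- A parametric interval integral with smooth integrand is smooth. -/
theorem ContDiff.parametric_intervalIntegral.{u} {E F : Type u} [NormedAddCommGroup E]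
    [NormedSpace ℝ E] [ProperSpace E] [NormedAddCommGroup F] [NormedSpace ℝ F]
    {f : E × ℝ → F} (hf : ContDiff ℝ (⊤ : ℕ∞) f) (c d : ℝ) :
    ContDiff ℝ (⊤ : ℕ∞) fun x => ∫ t in c..d, f (x, t) := by
  refine contDiff_infty.2 fun n => ?_
  induction n generalizing F with
  | zero =>
    exact contDiff_zero.2 <|
      intervalIntegral.continuous_parametric_intervalIntegral_of_continuous'
        (f := fun x t => f (x, t)) hf.continuous c d
  | succ n ih =>
    have key := hasFDerivAt_parametric_intervalIntegral (hf.of_le (by simp)) c d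
    rw [Nat.cast_add, Nat.cast_one, contDiff_succ_iff_fderiv]
    refine ⟨fun x => (key x).differentiableAt, by simp, ?_⟩
    rw [funext fun x => (key x).fderiv]
    exact ih ((hf.fderiv_right (by simp)).clm_comp contDiff_const)

/-- **Hadamard's lemma**: a smooth function is a base value plus a smoothly varying linear form. -/
theorem ContDiff.exists_eq_add_clm_apply.{u} {E F : Type u} [NormedAddCommGroup E]
    [NormedSpace ℝ E] [ProperSpace E] [NormedAddCommGroup F] [NormedSpace ℝ F] [CompleteSpace F]
    {f : E → F} (hf : ContDiff ℝ (⊤ : ℕ∞) f) :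
    ∃ G : E → E →L[ℝ] F, ContDiff ℝ (⊤ : ℕ∞) G ∧ G 0 = fderiv ℝ f 0 ∧
      ∀ x, f x = f 0 + G x x := by
  have hf' : ContDiff ℝ (⊤ : ℕ∞) (fderiv ℝ f) := hf.fderiv_right (by simp)
  refine ⟨fun x => ∫ t in (0 : ℝ)..1, fderiv ℝ f (t • x), ?_, by simp, fun x => ?_⟩
  · exact ContDiff.parametric_intervalIntegral
      (f := fun y : E × ℝ => fderiv ℝ f (y.2 • y.1))
      (hf'.comp (contDiff_snd.smul contDiff_fst)) 0 1
  · have hc : Continuous fun t : ℝ => fderiv ℝ f (t • x) :=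
      hf'.continuous.comp (continuous_id.smul continuous_const)
    have hd : ∀ t : ℝ, HasDerivAt (fun t : ℝ => f (t • x)) (fderiv ℝ f (t • x) x) t := by
      intro t
      have h1 : HasDerivAt (fun t : ℝ => t • x) x t := by
        simpa using (hasDerivAt_id t).smul_const x
      exact ((hf.differentiable (by simp)) (t • x)).hasFDerivAt.comp_hasDerivAt t h1
    rw [ContinuousLinearMap.intervalIntegral_apply (hc.intervalIntegrable _ _),
      intervalIntegral.integral_eq_sub_of_hasDerivAt (fun t _ => hd t)
        ((hc.clm_apply continuous_const).intervalIntegrable _ _)]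
    simp

/-- Second-order Hadamard lemma in the plane at a critical point. -/
theorem ContDiff.exists_eq_quadratic {f : ℝ × ℝ → ℝ} (hf : ContDiff ℝ (⊤ : ℕ∞) f)
    (hf0 : fderiv ℝ f 0 = 0) :
    ∃ A B C : ℝ × ℝ → ℝ, ContDiff ℝ (⊤ : ℕ∞) A ∧ ContDiff ℝ (⊤ : ℕ∞) B ∧
      ContDiff ℝ (⊤ : ℕ∞) C ∧
      ∀ x, f x = f 0 + (A x * x.1 ^ 2 + B x * (x.1 * x.2) + C x * x.2 ^ 2) := by
  obtain ⟨G, hG, hG0, hfG⟩ := hf.exists_eq_add_clm_apply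
  obtain ⟨K, hK, -, hGK⟩ := hG.exists_eq_add_clm_apply
  have hs : ∀ v w : ℝ × ℝ, ContDiff ℝ (⊤ : ℕ∞) fun x => K x v w := fun v w =>
    (hK.clm_apply contDiff_const).clm_apply contDiff_const
  refine ⟨fun x => K x (1, 0) (1, 0), fun x => K x (1, 0) (0, 1) + K x (0, 1) (1, 0),
    fun x => K x (0, 1) (0, 1), hs _ _, (hs _ _).add (hs _ _), hs _ _, fun x => ?_⟩
  have hx : x = x.1 • ((1, 0) : ℝ × ℝ) + x.2 • ((0, 1) : ℝ × ℝ) := by ext <;> simp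
  have : K x x x = K x (x.1 • ((1, 0) : ℝ × ℝ) + x.2 • ((0, 1) : ℝ × ℝ))
      (x.1 • ((1, 0) : ℝ × ℝ) + x.2 • ((0, 1) : ℝ × ℝ)) := by rw [← hx]
  rw [hfG x, hGK x, hG0, hf0, zero_add, this]
  simp only [map_add, map_smul, add_apply, smul_apply, smul_eq_mul]
  ring

theorem deriv_deriv_const_add_mul_sq {m : ℝ → ℝ} (hm : ContDiff ℝ (⊤ : ℕ∞) m) (c : ℝ) :
    deriv (deriv fun t => c + m t * t ^ 2) 0 = 2 * m 0 := by
  have hm' : ∀ t, HasDerivAt m (deriv m t) t := fun t =>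
    (hm.differentiable (by simp) t).hasDerivAt
  have hm'' : ∀ t, HasDerivAt (deriv m) (deriv (deriv m) t) t := fun t =>
    ((contDiff_infty_iff_deriv.1 hm).2.differentiable (by simp) t).hasDerivAt
  have h1 : (deriv fun t => c + m t * t ^ 2) = fun t => deriv m t * t ^ 2 + m t * (2 * t) := by
    funext t
    exact ((((hm' t).mul (hasDerivAt_pow 2 t)).const_add c).congr_deriv (by simp)).deriv
  rw [h1]
  exact ((((hm'' 0).mul (hasDerivAt_pow 2 0)).add
    ((hm' 0).mul ((hasDerivAt_id (0 : ℝ)).const_mul 2))).congr_deriv (by simp; ring)).deriv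

theorem fderiv_eq_zero_of_pd {h : ℝ → ℝ → ℝ}
    (hh : ContDiff ℝ (⊤ : ℕ∞) fun x : ℝ × ℝ => h x.1 x.2)
    (hu : pd 1 0 h 0 0 = 0) (hw : pd 0 1 h 0 0 = 0) :
    fderiv ℝ (fun x : ℝ × ℝ => h x.1 x.2) 0 = 0 := by
  have hd := (hh.differentiable (by simp) 0).hasFDerivAt
  have h1 := (hd.comp_hasDerivAt_of_eq (0 : ℝ)
    ((hasDerivAt_id (0 : ℝ)).prodMk (hasDerivAt_const (0 : ℝ) (0 : ℝ))) rfl).deriv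
  have h2 := (hd.comp_hasDerivAt_of_eq (0 : ℝ)
    ((hasDerivAt_const (0 : ℝ) (0 : ℝ)).prodMk (hasDerivAt_id (0 : ℝ))) rfl).deriv
  have e1 : pd 1 0 h 0 0 = _ := h1
  have e2 : pd 0 1 h 0 0 = _ := h2
  ext
  · simpa using e1.symm.trans hu
  · simpa using e2.symm.trans hw

section QuadraticCoefficients

variable {h : ℝ → ℝ → ℝ} {c : ℝ} {A B C : ℝ × ℝ → ℝ}

theorem pd_two_zero_of_quadratic (hA : ContDiff ℝ (⊤ : ℕ∞) A)
    (hq : ∀ u w, h u w = c + (A (u, w) * u ^ 2 + B (u, w) * (u * w) + C (u, w) * w ^ 2)) :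
    pd 2 0 h 0 0 = 2 * A 0 := by
  have h1 : (fun t => h t 0) = fun t => c + A (t, 0) * t ^ 2 := by
    funext t; simp [hq]
  change deriv (deriv fun t => h t 0) 0 = _
  rw [h1]
  exact deriv_deriv_const_add_mul_sq (hA.comp (contDiff_id.prodMk contDiff_const)) c

theorem pd_zero_two_of_quadratic (hC : ContDiff ℝ (⊤ : ℕ∞) C)
    (hq : ∀ u w, h u w = c + (A (u, w) * u ^ 2 + B (u, w) * (u * w) + C (u, w) * w ^ 2)) :
    pd 0 2 h 0 0 = 2 * C 0 := by
  have h1 : (fun t => h 0 t) = fun t => c + C (0, t) * t ^ 2 := by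
    funext t; simp [hq]
  change deriv (deriv fun t => h 0 t) 0 = _
  rw [h1]
  exact deriv_deriv_const_add_mul_sq (hC.comp (contDiff_const.prodMk contDiff_id)) c

theorem pd_one_one_of_quadratic (hA : ContDiff ℝ (⊤ : ℕ∞) A) (hB : ContDiff ℝ (⊤ : ℕ∞) B)
    (hC : ContDiff ℝ (⊤ : ℕ∞) C)
    (hq : ∀ u w, h u w = c + (A (u, w) * u ^ 2 + B (u, w) * (u * w) + C (u, w) * w ^ 2)) :
    pd 1 1 h 0 0 = B 0 := by
  have hp : ∀ {D : ℝ × ℝ → ℝ}, ContDiff ℝ (⊤ : ℕ∞) D → ∀ t,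
      HasDerivAt (fun s => D (t, s)) (fderiv ℝ D (t, 0) (0, 1)) 0 := fun hD t =>
    (hD.differentiable (by simp) (t, 0)).hasFDerivAt.comp_hasDerivAt_of_eq (0 : ℝ)
      ((hasDerivAt_const (0 : ℝ) t).prodMk (hasDerivAt_id (0 : ℝ))) rfl
  have h1 : (fun t => deriv (fun s => h t s) 0) =
      fun t => fderiv ℝ A (t, 0) (0, 1) * t ^ 2 + B (t, 0) * t := by
    funext t
    simp only [hq]
    refine HasDerivAt.deriv ?_
    refine (((((hp hA t).mul_const (t ^ 2)).add ((hp hB t).mul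
      ((hasDerivAt_id (0 : ℝ)).const_mul t))).add
      ((hp hC t).mul (hasDerivAt_pow 2 (0 : ℝ)))).const_add c).congr_deriv ?_
    simp
  change deriv (fun t => deriv (fun s => h t s) 0) 0 = _
  rw [h1]
  have hA' : Differentiable ℝ fun t : ℝ => fderiv ℝ A (t, 0) (0, 1) := by
    have : ContDiff ℝ (⊤ : ℕ∞) fun t : ℝ => fderiv ℝ A (t, 0) (0, 1) :=
      (((hA.fderiv_right (m := (⊤ : ℕ∞)) (by simp)).comp
        (contDiff_id.prodMk contDiff_const)).clm_apply contDiff_const)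
    exact this.differentiable (by simp)
  have hB' : Differentiable ℝ fun t : ℝ => B (t, 0) :=
    (hB.comp (contDiff_id.prodMk contDiff_const)).differentiable (by simp)
  refine HasDerivAt.deriv ((((hA' 0).hasDerivAt.mul (hasDerivAt_pow 2 (0 : ℝ))).add
    ((hB' 0).hasDerivAt.mul (hasDerivAt_id (0 : ℝ)))).congr_deriv ?_)
  simp
  rfl

/-- If `h` is a sum of signed squares of the components of `ψ`, then its quadratic part is the
corresponding pull-back under the derivative of `ψ`. -/
theorem quadratic_part_eq (hA : Continuous A) (hB : Continuous B) (hC : Continuous C)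
    (hq : ∀ u w, h u w = c + (A (u, w) * u ^ 2 + B (u, w) * (u * w) + C (u, w) * w ^ 2))
    {ψ : ℝ × ℝ → ℝ × ℝ} {L : ℝ × ℝ →L[ℝ] ℝ × ℝ} (hψ : HasFDerivAt ψ L 0) (hψ0 : ψ 0 = 0)
    {ε₁ ε₂ : ℝ}
    (hev : ∀ᶠ y in 𝓝 (0 : ℝ × ℝ), h y.1 y.2 = c + ε₁ * (ψ y).1 ^ 2 + ε₂ * (ψ y).2 ^ 2)
    (v : ℝ × ℝ) :
    A 0 * v.1 ^ 2 + B 0 * (v.1 * v.2) + C 0 * v.2 ^ 2 =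
      ε₁ * (L v).1 ^ 2 + ε₂ * (L v).2 ^ 2 := by
  have hline : Continuous fun t : ℝ => t • v := continuous_id.smul continuous_const
  have hline0 : Tendsto (fun t : ℝ => t • v) (𝓝[≠] 0) (𝓝 0) := by
    have := hline.tendsto 0
    rw [zero_smul] at this
    exact this.mono_left nhdsWithin_le_nhds
  have hslope : Tendsto (fun t : ℝ => t⁻¹ • ψ (t • v)) (𝓝[≠] 0) (𝓝 (L v)) := by
    have hd : HasDerivAt (fun t : ℝ => ψ (t • v)) (L v) 0 := by
      have h1 : HasDerivAt (fun t : ℝ => t • v) v 0 := by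
        simpa using (hasDerivAt_id (0 : ℝ)).smul_const v
      exact hψ.comp_hasDerivAt_of_eq (0 : ℝ) h1 (by simp)
    simpa [hψ0] using hd.tendsto_slope_zero
  have hl : Tendsto (fun t : ℝ => A (t • v) * v.1 ^ 2 + B (t • v) * (v.1 * v.2) +
      C (t • v) * v.2 ^ 2) (𝓝[≠] 0)
      (𝓝 (A 0 * v.1 ^ 2 + B 0 * (v.1 * v.2) + C 0 * v.2 ^ 2)) :=
    ((((hA.tendsto 0).comp hline0).mul_const _).add
      (((hB.tendsto 0).comp hline0).mul_const _)).add (((hC.tendsto 0).comp hline0).mul_const _)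
  have hr : Tendsto (fun t : ℝ => ε₁ * (t⁻¹ • ψ (t • v)).1 ^ 2 + ε₂ * (t⁻¹ • ψ (t • v)).2 ^ 2)
      (𝓝[≠] 0) (𝓝 (ε₁ * (L v).1 ^ 2 + ε₂ * (L v).2 ^ 2)) :=
    (((hslope.fst_nhds).pow 2).const_mul ε₁).add (((hslope.snd_nhds).pow 2).const_mul ε₂)
  refine tendsto_nhds_unique (hl.congr' ?_) hr
  filter_upwards [hline0.eventually hev, self_mem_nhdsWithin] with t ht ht0
  have ht0' : t ≠ 0 := ht0
  rw [hq] at ht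
  simp only [Prod.smul_fst, Prod.smul_snd, smul_eq_mul] at ht ⊢
  have e : ((t * v.1, t * v.2) : ℝ × ℝ) = t • v := rfl
  rw [e] at ht
  field_simp
  linear_combination ht

end QuadraticCoefficients

theorem HasAkSingAt.pd_two_zero_ne_zero {h : ℝ → ℝ → ℝ}
    (hh : ContDiff ℝ (⊤ : ℕ∞) fun x : ℝ × ℝ => h x.1 x.2)
    (hu : pd 1 0 h 0 0 = 0) (hw : pd 0 1 h 0 0 = 0) (huw : pd 1 1 h 0 0 = 0)
    (hA1 : HasAkSingAt h 1) : pd 2 0 h 0 0 ≠ 0 := by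
  obtain ⟨A, B, C, hA, hB, hC, hq⟩ := hh.exists_eq_quadratic (fderiv_eq_zero_of_pd hh hu hw)
  replace hq : ∀ u w, h u w = h 0 0 +
      (A (u, w) * u ^ 2 + B (u, w) * (u * w) + C (u, w) * w ^ 2) := fun u w => hq (u, w)
  intro huu
  rw [pd_two_zero_of_quadratic hA hq] at huu
  rw [pd_one_one_of_quadratic hA hB hC hq] at huw
  obtain ⟨U, V, φ, ψ, ε₁, ε₂, hU, hV, h0U, h0V, hφ, hψ, hUV, hVU, hψφ, hφψ, hφ0, hε₁, hε₂, hform⟩ :=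
    hA1
  have hψ0 : ψ 0 = 0 := by
    have := hψφ _ h0U
    rwa [hφ0] at this
  have hφd : HasFDerivAt φ (fderiv ℝ φ 0) 0 :=
    ((hφ.contDiffAt (hU.mem_nhds h0U)).differentiableAt (by simp)).hasFDerivAt
  have hψd : HasFDerivAt ψ (fderiv ℝ ψ 0) 0 :=
    ((hψ.contDiffAt (hV.mem_nhds h0V)).differentiableAt (by simp)).hasFDerivAt
  set L := fderiv ℝ ψ 0
  set M := fderiv ℝ φ 0
  have hLM : ∀ v, L (M v) = v := by
    have h1 : HasFDerivAt (ψ ∘ φ) (L.comp M) 0 :=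
      HasFDerivAt.comp (0 : ℝ × ℝ) (by rw [show φ 0 = 0 from hφ0]; exact hψd) hφd
    have h2 : HasFDerivAt (ψ ∘ φ) (ContinuousLinearMap.id ℝ (ℝ × ℝ)) 0 :=
      (hasFDerivAt_id 0).congr_of_eventuallyEq
        (Filter.eventually_of_mem (hU.mem_nhds h0U) hψφ)
    exact fun v => DFunLike.congr_fun (h1.unique h2) v
  have hML : ∀ v, M (L v) = v := by
    have h1 : HasFDerivAt (φ ∘ ψ) (M.comp L) 0 :=
      HasFDerivAt.comp (0 : ℝ × ℝ) (by rw [hψ0]; exact hφd) hψd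
    have h2 : HasFDerivAt (φ ∘ ψ) (ContinuousLinearMap.id ℝ (ℝ × ℝ)) 0 :=
      (hasFDerivAt_id 0).congr_of_eventuallyEq
        (Filter.eventually_of_mem (hV.mem_nhds h0V) hφψ)
    exact fun v => DFunLike.congr_fun (h1.unique h2) v
  have hev : ∀ᶠ y in 𝓝 (0 : ℝ × ℝ),
      h y.1 y.2 = h 0 0 + ε₁ * (ψ y).1 ^ 2 + ε₂ * (ψ y).2 ^ 2 := by
    filter_upwards [hV.mem_nhds h0V] with y hy
    have := hform (ψ y) (hVU hy)
    rwa [hφψ y hy] at this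
  have key := quadratic_part_eq hA.continuous hB.continuous hC.continuous hq hψd hψ0 hev
  have hA0 : A 0 = 0 := by linarith
  have hcross : ∀ v : ℝ × ℝ, ε₁ * ((L (1, 0)).1 * v.1) + ε₂ * ((L (1, 0)).2 * v.2) = 0 := by
    intro v
    have k1 := key (M v + (1, 0))
    have k2 := key (M v)
    have k3 := key (1, 0)
    simp only [map_add, hLM, hA0, huw, Prod.fst_add, Prod.snd_add] at k1 k2 k3
    linear_combination (k2 + k3 - k1) / 2
  have hL0 : L (1, 0) = 0 := by
    have c1 := hcross (1, 0)
    have c2 := hcross (0, 1)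
    have hε₁' : ε₁ ≠ 0 := by rcases hε₁ with rfl | rfl <;> norm_num
    have hε₂' : ε₂ ≠ 0 := by rcases hε₂ with rfl | rfl <;> norm_num
    ext
    · simpa [hε₁'] using c1
    · simpa [hε₂'] using c2
  have := hML (1, 0)
  simp [hL0, Prod.ext_iff] at this

/-- The inverse function theorem, with smoothness of the map and of its inverse on open sets. -/
theorem ContDiffOn.exists_smooth_local_inverse {E F : Type*} [NormedAddCommGroup E]
    [NormedSpace ℝ E] [CompleteSpace E] [NormedAddCommGroup F] [NormedSpace ℝ F]
    {ψ : E → F} {W : Set E} {a : E} (hW : IsOpen W) (ha : a ∈ W)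
    (hψ : ContDiffOn ℝ (⊤ : ℕ∞) ψ W) {e : E ≃L[ℝ] F} (he : HasFDerivAt ψ (e : E →L[ℝ] F) a) :
    ∃ (V : Set E) (U : Set F) (φ : F → E), IsOpen V ∧ IsOpen U ∧ V ⊆ W ∧ a ∈ V ∧
      ContDiffOn ℝ (⊤ : ℕ∞) φ U ∧ MapsTo φ U V ∧ MapsTo ψ V U ∧
      (∀ x ∈ U, ψ (φ x) = x) ∧ ∀ y ∈ V, φ (ψ y) = y := by
  have hat : ContDiffAt ℝ (⊤ : ℕ∞) ψ a := hψ.contDiffAt (hW.mem_nhds ha)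
  let Φ := hat.toOpenPartialHomeomorph ψ he (by simp)
  have hΦ : ∀ x, Φ x = ψ x := fun _ => rfl
  set W' : Set E := W ∩ fderiv ℝ ψ ⁻¹' Set.range ((↑) : (E ≃L[ℝ] F) → E →L[ℝ] F)
  have hW' : IsOpen W' :=
    (hψ.continuousOn_fderiv_of_isOpen hW (by simp)).isOpen_inter_preimage hW
      ContinuousLinearEquiv.isOpen
  refine ⟨Φ.source ∩ W', Φ.target ∩ Φ.symm ⁻¹' W', Φ.symm, Φ.open_source.inter hW',
    Φ.isOpen_inter_preimage_symm hW', fun x hx => hx.2.1,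
    ⟨hat.mem_toOpenPartialHomeomorph_source he (by simp), ha, e, he.fderiv.symm⟩, ?_,
    fun x hx => ⟨Φ.map_target hx.1, hx.2⟩, fun x hx => ⟨Φ.map_source hx.1, ?_⟩,
    fun x hx => Φ.right_inv hx.1, fun y hy => Φ.left_inv hy.1⟩
  · rintro x ⟨hx, hxW, e', he'⟩
    have hx' : ContDiffAt ℝ (⊤ : ℕ∞) ψ (Φ.symm x) := hψ.contDiffAt (hW.mem_nhds hxW)
    refine (Φ.contDiffAt_symm hx (f₀' := e') ?_ hx').contDiffWithinAt
    rw [he']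
    exact (hx'.differentiableAt (by simp)).hasFDerivAt
  · change Φ.symm (Φ x) ∈ W'
    rw [Φ.left_inv hx.1]
    exact hx.2

theorem exists_sign_mul_pos {x : ℝ} (hx : x ≠ 0) : ∃ ε : ℝ, (ε = 1 ∨ ε = -1) ∧ 0 < ε * x := by
  rcases lt_or_gt_of_ne hx with h | h
  · exact ⟨-1, .inr rfl, by linarith⟩
  · exact ⟨1, .inl rfl, by linarith⟩

/-- **Morse lemma** in the plane, for a function whose quadratic part at the origin is diagonal. -/
theorem hasAkSingAt_one_of_quadratic {h : ℝ → ℝ → ℝ} {A B C : ℝ × ℝ → ℝ}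
    (hA : ContDiff ℝ (⊤ : ℕ∞) A) (hB : ContDiff ℝ (⊤ : ℕ∞) B) (hC : ContDiff ℝ (⊤ : ℕ∞) C)
    (hq : ∀ u w, h u w = h 0 0 + (A (u, w) * u ^ 2 + B (u, w) * (u * w) + C (u, w) * w ^ 2))
    (hA0 : A 0 ≠ 0) (hB0 : B 0 = 0) (hC0 : C 0 ≠ 0) : HasAkSingAt h 1 := by
  obtain ⟨ε₁, hε₁, hAε⟩ := exists_sign_mul_pos hA0
  obtain ⟨ε₂, hε₂, hCε⟩ := exists_sign_mul_pos hC0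
  let P : ℝ × ℝ → ℝ := fun x => ε₁ * A x
  let Q : ℝ × ℝ → ℝ := fun x => ε₁ * ε₂ * (4 * A x * C x - B x ^ 2)
  have hP : ContDiff ℝ (⊤ : ℕ∞) P := contDiff_const.mul hA
  have hQ : ContDiff ℝ (⊤ : ℕ∞) Q :=
    contDiff_const.mul (((contDiff_const.mul hA).mul hC).sub (hB.pow 2))
  let W : Set (ℝ × ℝ) := {x | 0 < P x} ∩ {x | 0 < Q x}
  have hW : IsOpen W :=
    (isOpen_lt continuous_const hP.continuous).inter (isOpen_lt continuous_const hQ.continuous)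
  have h0W : (0 : ℝ × ℝ) ∈ W := by
    refine ⟨hAε, ?_⟩
    change 0 < ε₁ * ε₂ * (4 * A 0 * C 0 - B 0 ^ 2)
    rw [hB0]
    nlinarith [mul_pos hAε hCε]
  let s₁ : ℝ × ℝ → ℝ := fun x => √(P x)
  let s₂ : ℝ × ℝ → ℝ := fun x => √(Q x / (4 * P x))
  let r : ℝ × ℝ → ℝ := fun x => ε₁ * B x / (2 * P x)
  have hdiv : ∀ x ∈ W, 0 < Q x / (4 * P x) := fun x hx =>
    div_pos hx.2 (mul_pos four_pos hx.1)
  have hs₁ : ContDiffOn ℝ (⊤ : ℕ∞) s₁ W := hP.contDiffOn.sqrt fun x hx => hx.1.ne'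
  have hs₂ : ContDiffOn ℝ (⊤ : ℕ∞) s₂ W :=
    (hQ.contDiffOn.div (contDiff_const.mul hP).contDiffOn
      fun x hx => (mul_pos four_pos hx.1).ne').sqrt fun x hx => (hdiv x hx).ne'
  have hr : ContDiffOn ℝ (⊤ : ℕ∞) r W :=
    (contDiff_const.mul hB).contDiffOn.div (contDiff_const.mul hP).contDiffOn
      fun x hx => (mul_pos two_pos hx.1).ne'
  let ℓ : ℝ × ℝ → ℝ := fun x => x.1 + r x * x.2
  have hℓ : ContDiffOn ℝ (⊤ : ℕ∞) ℓ W := contDiffOn_fst.add (hr.mul contDiffOn_snd)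
  let ψ : ℝ × ℝ → ℝ × ℝ := fun x => (s₁ x * ℓ x, s₂ x * x.2)
  have hψ : ContDiffOn ℝ (⊤ : ℕ∞) ψ W := (hs₁.mul hℓ).prodMk (hs₂.mul contDiffOn_snd)
  have hψ0 : ψ 0 = 0 := by simp [ψ, ℓ]
  have hd : ∀ {f : ℝ × ℝ → ℝ}, ContDiffOn ℝ (⊤ : ℕ∞) f W → HasFDerivAt f (fderiv ℝ f 0) 0 :=
    fun hf => ((hf.contDiffAt (hW.mem_nhds h0W)).differentiableAt (by simp)).hasFDerivAt
  let e : (ℝ × ℝ) ≃L[ℝ] ℝ × ℝ :=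
    (ContinuousLinearEquiv.smulLeft (Units.mk0 (s₁ 0) (Real.sqrt_pos.2 h0W.1).ne')).prodCongr
      (ContinuousLinearEquiv.smulLeft (Units.mk0 (s₂ 0) (Real.sqrt_pos.2 (hdiv 0 h0W)).ne'))
  have he : HasFDerivAt ψ (e : ℝ × ℝ →L[ℝ] ℝ × ℝ) 0 := by
    have hℓd := (hasFDerivAt_fst (𝕜 := ℝ) (p := (0 : ℝ × ℝ))).add
      ((hd hr).mul (hasFDerivAt_snd (𝕜 := ℝ) (p := (0 : ℝ × ℝ))))
    have hr0 : r 0 = 0 := by simp [r, hB0]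
    refine (((hd hs₁).mul hℓd).prodMk
      ((hd hs₂).mul (hasFDerivAt_snd (𝕜 := ℝ) (p := (0 : ℝ × ℝ))))).congr_fderiv ?_
    ext <;> simp [e, hr0, Units.smul_def]
  obtain ⟨V, U, φ, hV, hU, hVW, h0V, hφ, hφU, hψV, hψφ, hφψ⟩ :=
    hψ.exists_smooth_local_inverse hW h0W he
  refine ⟨U, V, φ, ψ, ε₁, ε₂, hU, hV, ?_, h0V, hφ, hψ.mono hVW, hφU, hψV, hψφ, hφψ, ?_,
    hε₁, hε₂, fun x hx => ?_⟩
  · have := hψV h0V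
    rwa [hψ0] at this
  · have := hφψ 0 h0V
    rwa [hψ0] at this
  · have hy := hφU hx
    rw [← hψφ x hx, hφψ _ hy]
    generalize φ x = y at hy
    have hPy : 0 < P y := (hVW hy).1
    have e₁ : s₁ y ^ 2 = P y := Real.sq_sqrt hPy.le
    have e₂ : s₂ y ^ 2 = Q y / (4 * P y) := Real.sq_sqrt (hdiv y (hVW hy)).le
    have hAy : A y ≠ 0 := right_ne_zero_of_mul hPy.ne'
    rw [hq]
    simp only [ψ, ℓ, mul_pow, e₁, e₂, r, P, Q]
    rcases hε₁ with rfl | rfl <;> rcases hε₂ with rfl | rfl <;> field_simp <;> ring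

theorem hasAkSingAt_one_iff {h : ℝ → ℝ → ℝ}
    (hh : ContDiff ℝ (⊤ : ℕ∞) fun x : ℝ × ℝ => h x.1 x.2)
    (hu : pd 1 0 h 0 0 = 0) (hw : pd 0 1 h 0 0 = 0) (huw : pd 1 1 h 0 0 = 0)
    (hww : pd 0 2 h 0 0 ≠ 0) : HasAkSingAt h 1 ↔ pd 2 0 h 0 0 ≠ 0 := by
  refine ⟨fun H => H.pd_two_zero_ne_zero hh hu hw huw, fun huu => ?_⟩
  obtain ⟨A, B, C, hA, hB, hC, hq⟩ := hh.exists_eq_quadratic (fderiv_eq_zero_of_pd hh hu hw)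
  replace hq : ∀ u w, h u w = h 0 0 +
      (A (u, w) * u ^ 2 + B (u, w) * (u * w) + C (u, w) * w ^ 2) := fun u w => hq (u, w)
  rw [pd_two_zero_of_quadratic hA hq] at huu
  rw [pd_zero_two_of_quadratic hC hq] at hww
  rw [pd_one_one_of_quadratic hA hB hC hq] at huw
  exact hasAkSingAt_one_of_quadratic hA hB hC hq (right_ne_zero_of_mul huu) huw
    (right_ne_zero_of_mul hww)

section LinearCombination

variable {p q : ℝ → ℝ → ℝ}

theorem hasDerivAt_pdu (hp : ContDiff ℝ (⊤ : ℕ∞) fun x : ℝ × ℝ => p x.1 x.2) (u w : ℝ) :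
    HasDerivAt (fun t => p t w) (pdu p u w) u :=
  ((hp.comp (contDiff_id.prodMk contDiff_const)).differentiable (by simp) u).hasDerivAt

theorem hasDerivAt_pdw (hp : ContDiff ℝ (⊤ : ℕ∞) fun x : ℝ × ℝ => p x.1 x.2) (u w : ℝ) :
    HasDerivAt (fun t => p u t) (pdw p u w) w :=
  ((hp.comp (contDiff_const.prodMk contDiff_id)).differentiable (by simp) w).hasDerivAt

theorem contDiff_pdu (hp : ContDiff ℝ (⊤ : ℕ∞) fun x : ℝ × ℝ => p x.1 x.2) :
    ContDiff ℝ (⊤ : ℕ∞) fun x : ℝ × ℝ => pdu p x.1 x.2 := by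
  have h1 : ∀ x : ℝ × ℝ, pdu p x.1 x.2 = fderiv ℝ (fun x : ℝ × ℝ => p x.1 x.2) x (1, 0) :=
    fun x => ((hp.differentiable (by simp) x).hasFDerivAt.comp_hasDerivAt_of_eq x.1
      ((hasDerivAt_id x.1).prodMk (hasDerivAt_const x.1 x.2)) rfl).deriv
  simp only [h1]
  exact (hp.fderiv_right (by simp)).clm_apply contDiff_const

theorem contDiff_pdw (hp : ContDiff ℝ (⊤ : ℕ∞) fun x : ℝ × ℝ => p x.1 x.2) :
    ContDiff ℝ (⊤ : ℕ∞) fun x : ℝ × ℝ => pdw p x.1 x.2 := by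
  have h1 : ∀ x : ℝ × ℝ, pdw p x.1 x.2 = fderiv ℝ (fun x : ℝ × ℝ => p x.1 x.2) x (0, 1) :=
    fun x => ((hp.differentiable (by simp) x).hasFDerivAt.comp_hasDerivAt_of_eq x.2
      ((hasDerivAt_const x.2 x.1).prodMk (hasDerivAt_id x.2)) rfl).deriv
  simp only [h1]
  exact (hp.fderiv_right (by simp)).clm_apply contDiff_const

theorem pdu_linear_combination (hp : ContDiff ℝ (⊤ : ℕ∞) fun x : ℝ × ℝ => p x.1 x.2)
    (hq : ContDiff ℝ (⊤ : ℕ∞) fun x : ℝ × ℝ => q x.1 x.2) (α β : ℝ) :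
    pdu (fun u w => α * p u w + β * q u w) = fun u w => α * pdu p u w + β * pdu q u w := by
  funext u w
  exact (((hasDerivAt_pdu hp u w).const_mul α).add ((hasDerivAt_pdu hq u w).const_mul β)).deriv

theorem pdw_linear_combination (hp : ContDiff ℝ (⊤ : ℕ∞) fun x : ℝ × ℝ => p x.1 x.2)
    (hq : ContDiff ℝ (⊤ : ℕ∞) fun x : ℝ × ℝ => q x.1 x.2) (α β : ℝ) :
    pdw (fun u w => α * p u w + β * q u w) = fun u w => α * pdw p u w + β * pdw q u w := by
  funext u w
  exact (((hasDerivAt_pdw hp u w).const_mul α).add ((hasDerivAt_pdw hq u w).const_mul β)).deriv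

theorem contDiff_pdw_iterate (hp : ContDiff ℝ (⊤ : ℕ∞) fun x : ℝ × ℝ => p x.1 x.2) (j : ℕ) :
    ContDiff ℝ (⊤ : ℕ∞) fun x : ℝ × ℝ => pdw^[j] p x.1 x.2 := by
  induction j generalizing p with
  | zero => exact hp
  | succ j ih => exact ih (contDiff_pdw hp)

theorem pd_linear_combination (hp : ContDiff ℝ (⊤ : ℕ∞) fun x : ℝ × ℝ => p x.1 x.2)
    (hq : ContDiff ℝ (⊤ : ℕ∞) fun x : ℝ × ℝ => q x.1 x.2) (α β : ℝ) (i j : ℕ) :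
    pd i j (fun u w => α * p u w + β * q u w) =
      fun u w => α * pd i j p u w + β * pd i j q u w := by
  have hw : pdw^[j] (fun u w => α * p u w + β * q u w) =
      fun u w => α * pdw^[j] p u w + β * pdw^[j] q u w := by
    induction j generalizing p q with
    | zero => rfl
    | succ j ih =>
      simp only [Function.iterate_succ_apply, pdw_linear_combination hp hq]
      exact ih (contDiff_pdw hp) (contDiff_pdw hq)
  have hu : ∀ {P Q : ℝ → ℝ → ℝ}, (ContDiff ℝ (⊤ : ℕ∞) fun x : ℝ × ℝ => P x.1 x.2) →
      (ContDiff ℝ (⊤ : ℕ∞) fun x : ℝ × ℝ => Q x.1 x.2) →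
      pdu^[i] (fun u w => α * P u w + β * Q u w) =
        fun u w => α * pdu^[i] P u w + β * pdu^[i] Q u w := by
    induction i with
    | zero => intros; rfl
    | succ i ih =>
      intro P Q hP hQ
      simp only [Function.iterate_succ_apply, pdu_linear_combination hP hQ]
      exact ih (contDiff_pdu hP) (contDiff_pdu hQ)
  rw [pd, hw]
  exact hu (contDiff_pdw_iterate hp j) (contDiff_pdw_iterate hq j)

end LinearCombination

/-- For a normal form, the height function along a normal vector `(0, α, β)` with `α ≠ 0` has an
`A₁` singularity iff its second derivative along the singular curve does not vanish. -/
theorem NormalFormN.hasAkSingAt_hgt_one_iff {N : ℕ} {p q : ℝ → ℝ → ℝ} {b : ℕ → ℝ}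
    {a : ℕ → ℕ → ℝ} (hNF : NormalFormN N p q b a) (hN : 2 ≤ N) {α : ℝ} (hα : α ≠ 0) (β : ℝ) :
    HasAkSingAt (hgt p q (0, α, β)) 1 ↔ α * b 2 + β * a 2 0 ≠ 0 := by
  obtain ⟨hp, hq, -, -, hpu, hpw, hqu, hqw, hpww, hpb, hp0, hqa, ha11, ha02⟩ := hNF
  have hh : hgt p q (0, α, β) = fun u w => α * p u w + β * q u w := by
    funext u w
    simp only [hgt, gmap, dot3]
    ring
  have hpd : ∀ i j, pd i j (hgt p q (0, α, β)) 0 0 = α * pd i j p 0 0 + β * pd i j q 0 0 := by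
    intro i j
    rw [hh, pd_linear_combination hp hq]
  rw [hasAkSingAt_one_iff, hpd, hpb 2 le_rfl hN, hqa 2 0 le_rfl hN]
  · rw [hh]
    exact (contDiff_const.mul hp).add (contDiff_const.mul hq)
  · rw [hpd, hpu, hqu]; ring
  · rw [hpd, hpw, hqw]; ring
  · rw [hpd, hp0 1 1 le_rfl hN le_rfl (by simp), hqa 1 1 le_rfl hN, ha11]; ring
  · rw [hpd, hpww, hqa 0 2 le_rfl hN, ha02]
    simpa using hα

/-- for `ν₀ = ±(0, −a_{n+1,1} cos θ₀/A(θ₀), (n+1)! sin θ₀/A(θ₀))`, the height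
function `h_{ν₀}` has an `A₁` singularity at the origin iff `(0,θ₀)` is not a parabolic point
over the singularity. -/
theorem height_A1_over_singularity_iff (p q : ℝ → ℝ → ℝ) (b : ℕ → ℝ) (a : ℕ → ℕ → ℝ)
    (n : ℕ) (hn : 1 ≤ n) (hNF : NormalFormN (max 4 (n + 2)) p q b a)
    (hvan : ∀ i, 2 ≤ i → i ≤ n → a i 1 = 0) (hnz : a (n + 1) 1 ≠ 0)
    (θ₀ : ℝ) (hθ : θ₀ ∈ Set.Ioo (-(π / 2)) (π / 2)) (σ : ℝ) (hσ : σ = 1 ∨ σ = -1) :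
    HasAkSingAt
      (hgt p q
        (0,
          σ * (-(a (n + 1) 1) * Real.cos θ₀ /
            Real.sqrt (a (n + 1) 1 ^ 2 * Real.cos θ₀ ^ 2 +
              (Nat.factorial (n + 1) : ℝ) ^ 2 * Real.sin θ₀ ^ 2)),
          σ * ((Nat.factorial (n + 1) : ℝ) * Real.sin θ₀ /
            Real.sqrt (a (n + 1) 1 ^ 2 * Real.cos θ₀ ^ 2 +
              (Nat.factorial (n + 1) : ℝ) ^ 2 * Real.sin θ₀ ^ 2)))) 1 ↔
      a (n + 1) 1 * b 2 * Real.cos θ₀ - (Nat.factorial (n + 1) : ℝ) * a 2 0 * Real.sin θ₀ ≠ 0 := by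
  have hcos : 0 < Real.cos θ₀ := Real.cos_pos_of_mem_Ioo hθ
  set S := Real.sqrt (a (n + 1) 1 ^ 2 * Real.cos θ₀ ^ 2 +
    (Nat.factorial (n + 1) : ℝ) ^ 2 * Real.sin θ₀ ^ 2)
  have hS : S ≠ 0 := (Real.sqrt_pos.2 (by positivity)).ne'
  have hσ0 : σ ≠ 0 := by rcases hσ with rfl | rfl <;> norm_num
  rw [hNF.hasAkSingAt_hgt_one_iff (le_max_of_le_left (by norm_num))
    (mul_ne_zero hσ0 (div_ne_zero (mul_ne_zero (neg_ne_zero.2 hnz) hcos.ne') hS)), not_iff_not]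
  have hfac : σ * (-(a (n + 1) 1) * Real.cos θ₀ / S) * b 2 +
      σ * ((Nat.factorial (n + 1) : ℝ) * Real.sin θ₀ / S) * a 2 0 =
      -(σ / S) * (a (n + 1) 1 * b 2 * Real.cos θ₀ -
        (Nat.factorial (n + 1) : ℝ) * a 2 0 * Real.sin θ₀) := by
    ring
  rw [hfac, mul_eq_zero, or_iff_right (neg_ne_zero.2 (div_ne_zero hσ0 hS))]
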